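/- Let σ* be the star subdivision of a full-dimensional cone σ with respect to the ray ρ_v generated by v = Star(σ). Then ρ_v is the unique minimal cone of σ* whose relative interior meets the relative interior of σ; consequently every cone of σ* meeting the interior of σ contains ρ_v. -/

import Mathlib

/-- The convex cone generated by a set `S ⊆ ℝⁿ`: all finite nonnegative combinations of
elements of `S`. -/
def coneGen {n : ℕ} (S : Set (Fin n → ℝ)) : Set (Fin n → ℝ) :=
  {x | ∃ (t : Finset (Fin n → ℝ)) (c : (Fin n → ℝ) → ℝ),
    ↑t ⊆ S ∧ (∀ y, 0 ≤ c y) ∧ x = ∑ y ∈ t, c y • y}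

/-- `τ` is a face of the cone `σ`: `τ` is a subcone of `σ` such that whenever a sum of two
elements of `σ` lies in `τ`, both elements lie in `τ`. -/
def IsFaceOf {n : ℕ} (τ σ : Set (Fin n → ℝ)) : Prop :=
  τ ⊆ σ ∧ (∀ x ∈ τ, ∀ y ∈ τ, x + y ∈ τ) ∧ (∀ x ∈ τ, ∀ c : ℝ, 0 ≤ c → c • x ∈ τ) ∧
    (∀ x ∈ σ, ∀ y ∈ σ, x + y ∈ τ → x ∈ τ ∧ y ∈ τ)

/-- `μ` is a facet of the full-dimensional cone `σ ⊆ ℝⁿ`: a face whose span has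
dimension `n - 1`. -/
def IsFacetOf {n : ℕ} (μ σ : Set (Fin n → ℝ)) : Prop :=
  IsFaceOf μ σ ∧ Module.finrank ℝ (Submodule.span ℝ μ) = n - 1

/-- The star subdivision `σ*` of the cone `σ` generated by `u` with respect to the vector
`v`: the fan whose cones are the faces of the cones `cone(μ, v)` for facets `μ` of `σ`. -/
def starSubdiv {n k : ℕ} (u : Fin k → (Fin n → ℝ)) (v : Fin n → ℝ) :
    Set (Set (Fin n → ℝ)) :=
  {τ | ∃ μ : Set (Fin n → ℝ), IsFacetOf μ (coneGen (Set.range u)) ∧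
    IsFaceOf τ (coneGen (μ ∪ {v}))}

theorem coneGen_zero {n : ℕ} (S : Set (Fin n → ℝ)) : (0 : Fin n → ℝ) ∈ coneGen S :=
  ⟨∅, 0, by simp, by simp, by simp⟩

theorem coneGen_mem {n : ℕ} {S : Set (Fin n → ℝ)} {x : Fin n → ℝ} (hx : x ∈ S) :
    x ∈ coneGen S :=
  ⟨{x}, 1, by simpa using hx, by simp, by simp⟩

theorem coneGen_smul {n : ℕ} {S : Set (Fin n → ℝ)} {x : Fin n → ℝ} (hx : x ∈ coneGen S)
    {a : ℝ} (ha : 0 ≤ a) : a • x ∈ coneGen S := by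
  obtain ⟨t, c, ht, hc, rfl⟩ := hx
  refine ⟨t, fun y => a * c y, ht, fun y => mul_nonneg ha (hc y), ?_⟩
  simp [Finset.smul_sum, mul_smul]

theorem coneGen_add {n : ℕ} {S : Set (Fin n → ℝ)} {x y : Fin n → ℝ} (hx : x ∈ coneGen S)
    (hy : y ∈ coneGen S) : x + y ∈ coneGen S := by
  classical
  obtain ⟨t, c, ht, hc, rfl⟩ := hx
  obtain ⟨t', c', ht', hc', rfl⟩ := hy
  refine ⟨t ∪ t', fun y => (if y ∈ t then c y else 0) + (if y ∈ t' then c' y else 0), ?_, ?_, ?_⟩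
  · simpa using ⟨ht, ht'⟩
  · intro y
    have := hc y
    have := hc' y
    dsimp only
    split_ifs <;> linarith
  · simp only [add_smul, Finset.sum_add_distrib, ite_smul, zero_smul]
    rw [Finset.sum_ite_mem, Finset.sum_ite_mem, Finset.union_inter_cancel_left,
      Finset.union_inter_cancel_right]

theorem coneGen_sum {n : ℕ} {S : Set (Fin n → ℝ)} {ι : Type*} (s : Finset ι)
    (f : ι → Fin n → ℝ) (hf : ∀ i ∈ s, f i ∈ coneGen S) : ∑ i ∈ s, f i ∈ coneGen S := by
  classical
  induction s using Finset.induction_on with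
  | empty => simpa using coneGen_zero S
  | insert a s ha ih =>
    rw [Finset.sum_insert ha]
    exact coneGen_add (hf a (by simp)) (ih fun i hi => hf i (by simp [hi]))

theorem coneGen_sub {n : ℕ} {S P : Set (Fin n → ℝ)} (h0 : 0 ∈ P)
    (hadd : ∀ x ∈ P, ∀ y ∈ P, x + y ∈ P) (hsmul : ∀ x ∈ P, ∀ c : ℝ, 0 ≤ c → c • x ∈ P)
    (hS : S ⊆ P) : coneGen S ⊆ P := by
  classical
  rintro x ⟨t, c, ht, hc, rfl⟩
  induction t using Finset.induction_on with
  | empty => simpa using h0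
  | insert a s ha ih =>
    rw [Finset.sum_insert ha]
    exact hadd _ (hsmul _ (hS (ht (by simp))) _ (hc _)) _
      (ih fun i hi => ht (by simp at hi; simp [hi]))

theorem coneGen_singleton {n : ℕ} {v x : Fin n → ℝ} :
    x ∈ coneGen {v} ↔ ∃ a : ℝ, 0 ≤ a ∧ x = a • v := by
  constructor
  · intro hx
    refine coneGen_sub (P := {x | ∃ a : ℝ, 0 ≤ a ∧ x = a • v}) ⟨0, le_rfl, by simp⟩ ?_ ?_ ?_ hx
    · rintro _ ⟨a, ha, rfl⟩ _ ⟨b, hb, rfl⟩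
      exact ⟨a + b, by positivity, by rw [add_smul]⟩
    · rintro _ ⟨a, ha, rfl⟩ c hc
      exact ⟨c * a, by positivity, by rw [mul_smul]⟩
    · rintro _ rfl
      exact ⟨1, by simp, by simp⟩
  · rintro ⟨a, ha, rfl⟩
    exact coneGen_smul (coneGen_mem (Set.mem_singleton v)) ha

/-- elements of `cone(μ, v)`. -/
theorem coneGen_union {n : ℕ} {μ : Set (Fin n → ℝ)} {v x : Fin n → ℝ}
    (hadd : ∀ x ∈ μ, ∀ y ∈ μ, x + y ∈ μ) (hsmul : ∀ x ∈ μ, ∀ c : ℝ, 0 ≤ c → c • x ∈ μ)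
    (hx : x ∈ coneGen (μ ∪ {v})) :
    ∃ m : Fin n → ℝ, (m ∈ μ ∨ m = 0) ∧ ∃ a : ℝ, 0 ≤ a ∧ x = m + a • v := by
  refine coneGen_sub
    (P := {x | ∃ m : Fin n → ℝ, (m ∈ μ ∨ m = 0) ∧ ∃ a : ℝ, 0 ≤ a ∧ x = m + a • v})
    ⟨0, Or.inr rfl, 0, le_rfl, by simp⟩ ?_ ?_ ?_ hx
  · rintro _ ⟨m, hm, a, ha, rfl⟩ _ ⟨m', hm', b, hb, rfl⟩
    refine ⟨m + m', ?_, a + b, by positivity, by rw [add_smul]; abel⟩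
    rcases hm with hm | rfl
    · rcases hm' with hm' | rfl
      · exact Or.inl (hadd _ hm _ hm')
      · simp [hm]
    · simpa using hm'
  · rintro _ ⟨m, hm, a, ha, rfl⟩ c hc
    refine ⟨c • m, ?_, c * a, by positivity, by rw [smul_add, mul_smul]⟩
    rcases hm with hm | rfl
    · exact Or.inl (hsmul _ hm _ hc)
    · simp
  · rintro y (hy | hy)
    · exact ⟨y, Or.inl hy, 0, le_rfl, by simp⟩
    · exact ⟨0, Or.inr rfl, 1, by simp, by simpa using hy⟩

theorem convex_coneGen {n : ℕ} (S : Set (Fin n → ℝ)) : Convex ℝ (coneGen S) := by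
  intro x hx y hy a b ha hb _
  exact coneGen_add (coneGen_smul hx ha) (coneGen_smul hy hb)

theorem v_mem_interior {n k : ℕ} (u : Fin k → (Fin n → ℝ))
    (hfull : Submodule.span ℝ (Set.range u) = ⊤) :
    ∑ i, u i ∈ interior (coneGen (Set.range u)) := by
  have hsurj : Function.Surjective (Fintype.linearCombination ℝ u) := by
    rw [← LinearMap.range_eq_top, Fintype.range_linearCombination, hfull]
  have hopen : IsOpenMap (Fintype.linearCombination ℝ u) :=
    LinearMap.isOpenMap_of_finiteDimensional _ hsurj
  rw [mem_interior]
  refine ⟨Fintype.linearCombination ℝ u '' (Set.univ.pi fun _ => Set.Ioi 0), ?_,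
    hopen _ (isOpen_set_pi Set.finite_univ fun _ _ => isOpen_Ioi), ⟨1, ?_, ?_⟩⟩
  · rintro _ ⟨c, hc, rfl⟩
    rw [Fintype.linearCombination_apply]
    exact coneGen_sum _ _ fun i _ => coneGen_smul (coneGen_mem (Set.mem_range_self i))
      (le_of_lt (hc i trivial))
  · intro i _
    simp
  · simp [Fintype.linearCombination_apply]

/-- an interior point dominates every vector. -/
theorem interior_dom {n : ℕ} {s : Set (Fin n → ℝ)} {x : Fin n → ℝ} (hx : x ∈ interior s)
    (y : Fin n → ℝ) : ∃ ε : ℝ, 0 < ε ∧ x + ε • y ∈ s := by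
  have hc : Filter.Tendsto (fun t : ℝ => x + t • y) (nhdsWithin 0 (Set.Ioi 0)) (nhds x) := by
    have : Continuous fun t : ℝ => x + t • y := by fun_prop
    have h := this.tendsto 0
    simp only [zero_smul, add_zero] at h
    exact h.mono_left nhdsWithin_le_nhds
  have h1 := hc.eventually (mem_interior_iff_mem_nhds.1 hx)
  obtain ⟨ε, h, h'⟩ := (h1.and self_mem_nhdsWithin).exists
  exact ⟨ε, h', h⟩

theorem mem_interior_of_intrinsic {n : ℕ} {s : Set (Fin n → ℝ)} (h : (interior s).Nonempty)
    {x : Fin n → ℝ} (hx : x ∈ intrinsicInterior ℝ s) : x ∈ interior s := by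
  have htop : affineSpan ℝ s = ⊤ := by
    rw [eq_top_iff, ← isOpen_interior.affineSpan_eq_top h]
    exact affineSpan_mono ℝ interior_subset
  obtain ⟨y, hy, rfl⟩ := mem_intrinsicInterior.1 hx
  have ho : IsOpen (affineSpan ℝ s : Set (Fin n → ℝ)) := by rw [htop]; simp
  have := ho.isOpenEmbedding_subtypeVal.isOpenMap
    (interior ((↑) ⁻¹' s : Set (affineSpan ℝ s))) isOpen_interior
  rw [mem_interior]
  refine ⟨_, ?_, this, ⟨y, hy, rfl⟩⟩
  rintro _ ⟨z, hz, rfl⟩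
  have hz' : z ∈ ((↑) ⁻¹' s : Set (affineSpan ℝ s)) := interior_subset hz
  exact hz'

theorem exists_pos_functional {n k : ℕ} (u : Fin k → (Fin n → ℝ))
    (hfull : Submodule.span ℝ (Set.range u) = ⊤)
    (h0 : (0 : Fin n → ℝ) ∉ interior (coneGen (Set.range u))) :
    ∃ l : Module.Dual ℝ (Fin n → ℝ), l ≠ 0 ∧ ∀ i, 0 ≤ l (u i) := by
  obtain ⟨f, hf⟩ := geometric_hahn_banach_open_point (convex_coneGen _).interior
    isOpen_interior h0
  have hv := hf _ (v_mem_interior u hfull)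
  rw [map_zero] at hv
  refine ⟨-(f : (Fin n → ℝ) →ₗ[ℝ] ℝ), ?_, ?_⟩
  · intro h
    have := congrArg (fun g : (Fin n → ℝ) →ₗ[ℝ] ℝ => g (∑ i, u i)) h
    simp only [LinearMap.neg_apply, ContinuousLinearMap.coe_coe, LinearMap.zero_apply] at this
    linarith
  · intro i
    have hcl : u i ∈ closure (interior (coneGen (Set.range u))) := by
      rw [(convex_coneGen _).closure_interior_eq_closure_of_nonempty_interior
        ⟨_, v_mem_interior u hfull⟩]
      exact subset_closure (coneGen_mem ⟨i, rfl⟩)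
    have : closure (interior (coneGen (Set.range u))) ⊆ {x | f x ≤ 0} := by
      refine closure_minimal ?_ (isClosed_le f.continuous continuous_const)
      intro x hx
      have := hf x hx
      rw [map_zero] at this
      exact this.le
    have := this hcl
    simpa using this

theorem eq_zero_of_vanish {n k : ℕ} (u : Fin k → (Fin n → ℝ))
    (hfull : Submodule.span ℝ (Set.range u) = ⊤) (l : Module.Dual ℝ (Fin n → ℝ))
    (h : ∀ i, l (u i) = 0) : l = 0 := by
  apply LinearMap.ext_on hfull
  rintro _ ⟨i, rfl⟩
  simp [h i]

theorem facet_step {n k : ℕ} (u : Fin k → (Fin n → ℝ))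
    (hfull : Submodule.span ℝ (Set.range u) = ⊤) (l : Module.Dual ℝ (Fin n → ℝ)) (hl : l ≠ 0)
    (hp : ∀ i, 0 ≤ l (u i))
    (hd : Module.finrank ℝ (Submodule.span ℝ (u '' {i | l (u i) = 0})) < n - 1) :
    ∃ l' : Module.Dual ℝ (Fin n → ℝ), l' ≠ 0 ∧ (∀ i, 0 ≤ l' (u i)) ∧
      Module.finrank ℝ (Submodule.span ℝ (u '' {i | l (u i) = 0})) <
      Module.finrank ℝ (Submodule.span ℝ (u '' {i | l' (u i) = 0})) := by
  set W := Submodule.span ℝ (u '' {i | l (u i) = 0}) with hW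
  have hann := Subspace.finrank_add_finrank_dualAnnihilator_eq W
  rw [Module.finrank_fin_fun] at hann
  obtain ⟨p, hpW, hpl⟩ : ∃ p ∈ W.dualAnnihilator, p ∉ Submodule.span ℝ {l} := by
    by_contra! hcon
    have h1 := Submodule.finrank_mono (show W.dualAnnihilator ≤ Submodule.span ℝ {l} from hcon)
    rw [finrank_span_singleton hl] at h1
    omega
  have hp0 : ∀ i, l (u i) = 0 → p (u i) = 0 := fun i hi =>
    (Submodule.mem_dualAnnihilator p).1 hpW _ (Submodule.subset_span ⟨i, hi, rfl⟩)
  -- choose sign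
  obtain ⟨q, hql, hq0, i₀, hi₀⟩ : ∃ q : Module.Dual ℝ (Fin n → ℝ), q ∉ Submodule.span ℝ {l} ∧
      (∀ i, l (u i) = 0 → q (u i) = 0) ∧ ∃ i, q (u i) < 0 := by
    by_cases h : ∃ i, p (u i) < 0
    · exact ⟨p, hpl, hp0, h⟩
    · push Not at h
      refine ⟨-p, by simpa using hpl, fun i hi => by simp [hp0 i hi], ?_⟩
      by_contra! hcon
      apply hpl
      rw [eq_zero_of_vanish u hfull p fun i => le_antisymm (by simpa using hcon i) (h i)]
      exact Submodule.zero_mem _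
  obtain ⟨j, hj, hmin⟩ := Finset.exists_min_image (Finset.univ.filter fun i => q (u i) < 0)
    (fun i => l (u i) / (-q (u i))) ⟨i₀, by simpa using hi₀⟩
  simp only [Finset.mem_filter, Finset.mem_univ, true_and] at hj hmin
  have hlj : l (u j) ≠ 0 := fun h => by rw [hq0 j h] at hj; exact lt_irrefl _ hj
  set t := l (u j) / (-q (u j)) with ht
  have ht0 : 0 ≤ t := div_nonneg (hp j) (by linarith)
  have hz : l (u j) + t * q (u j) = 0 := by
    have : q (u j) ≠ 0 := hj.ne
    rw [ht]; field_simp; ring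
  refine ⟨l + t • q, ?_, ?_, ?_⟩
  · intro h
    have htne : t ≠ 0 := by
      intro h'
      rw [h'] at hz
      simp at hz
      exact hlj hz
    apply hql
    rw [Submodule.mem_span_singleton]
    refine ⟨-t⁻¹, ?_⟩
    have : l = -(t • q) := eq_neg_of_add_eq_zero_left h
    rw [this, smul_neg, neg_smul, neg_neg, smul_smul, inv_mul_cancel₀ htne, one_smul]
  · intro i
    simp only [LinearMap.add_apply, LinearMap.smul_apply, smul_eq_mul]
    by_cases hqi : q (u i) < 0
    · have := hmin i hqi
      rw [le_div_iff₀ (by linarith)] at this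
      linarith
    · have := mul_nonneg ht0 (not_lt.1 hqi)
      have := hp i
      linarith
  · apply Submodule.finrank_lt_finrank_of_lt
    rw [SetLike.lt_iff_le_and_exists]
    refine ⟨Submodule.span_mono (Set.image_mono ?_), u j, Submodule.subset_span ⟨j, ?_, rfl⟩, ?_⟩
    · intro i hi
      have hi' : l (u i) = 0 := hi
      simp [hi', hq0 i hi']
    · simpa using hz
    · intro hmem
      have hle : W ≤ LinearMap.ker l := by
        rw [hW, Submodule.span_le]
        rintro _ ⟨i, hi, rfl⟩
        exact hi
      exact hlj (hle hmem)

theorem exists_facet_functional {n k : ℕ} (u : Fin k → (Fin n → ℝ))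
    (hfull : Submodule.span ℝ (Set.range u) = ⊤) (d : ℕ) (l : Module.Dual ℝ (Fin n → ℝ))
    (hl : l ≠ 0) (hp : ∀ i, 0 ≤ l (u i))
    (hd : n - 1 ≤ d + Module.finrank ℝ (Submodule.span ℝ (u '' {i | l (u i) = 0}))) :
    ∃ l : Module.Dual ℝ (Fin n → ℝ), l ≠ 0 ∧ (∀ i, 0 ≤ l (u i)) ∧
      n - 1 ≤ Module.finrank ℝ (Submodule.span ℝ (u '' {i | l (u i) = 0})) := by
  induction d generalizing l with
  | zero => exact ⟨l, hl, hp, by simpa using hd⟩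
  | succ d ih =>
    by_cases h : n - 1 ≤ Module.finrank ℝ (Submodule.span ℝ (u '' {i | l (u i) = 0}))
    · exact ⟨l, hl, hp, h⟩
    · obtain ⟨l', h1, h2, h3⟩ := facet_step u hfull l hl hp (not_le.1 h)
      exact ih l' h1 h2 (by omega)

theorem main_pos {n k : ℕ} (hn : n ≠ 0) (u : Fin k → (Fin n → ℝ))
    (σ : Set (Fin n → ℝ)) (hσ : σ = coneGen (Set.range u))
    (hfull : Submodule.span ℝ (Set.range u) = ⊤)
    (hstronglyconvex : ∀ x ∈ σ, -x ∈ σ → x = 0)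
    (v : Fin n → ℝ) (hv : v = ∑ i, u i) :
    coneGen {v} ∈ starSubdiv u v ∧
    (intrinsicInterior ℝ (coneGen {v}) ∩ intrinsicInterior ℝ σ).Nonempty ∧
    (∀ τ ∈ starSubdiv u v,
      (intrinsicInterior ℝ τ ∩ intrinsicInterior ℝ σ).Nonempty → coneGen {v} ⊆ τ) := by
  have hvint : v ∈ interior σ := by rw [hσ, hv]; exact v_mem_interior u hfull
  have hsm : ∀ {x : Fin n → ℝ}, x ∈ σ → ∀ {a : ℝ}, 0 ≤ a → a • x ∈ σ := by
    rw [hσ]; exact fun hx _ ha => coneGen_smul hx ha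
  have h0 : (0 : Fin n → ℝ) ∉ interior σ := by
    intro h0
    have hall : ∀ y : Fin n → ℝ, y ∈ σ := by
      intro y
      obtain ⟨ε, he, hy⟩ := interior_dom h0 y
      have := hsm hy (a := ε⁻¹) (by positivity)
      rwa [zero_add, smul_smul, inv_mul_cancel₀ he.ne', one_smul] at this
    have := congrFun (hstronglyconvex (fun _ => 1) (hall _) (hall _)) ⟨0, Nat.pos_of_ne_zero hn⟩
    simp at this
  obtain ⟨l₀, hl₀, hp₀⟩ := exists_pos_functional u hfull (hσ ▸ h0)
  obtain ⟨l, hl, hp, hd⟩ := exists_facet_functional u hfull (n - 1) l₀ hl₀ hp₀ (by omega)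
  have hlσ : ∀ x ∈ σ, 0 ≤ l x := by
    rw [hσ]
    refine coneGen_sub (P := {x | 0 ≤ l x}) (by simp) ?_ ?_ ?_
    · intro x hx y hy
      simp only [Set.mem_ofPred_eq, map_add] at *
      positivity
    · intro x hx c hc
      simp only [Set.mem_ofPred_eq, map_smul, smul_eq_mul] at *
      positivity
    · rintro _ ⟨i, rfl⟩
      exact hp i
  have hlv : 0 < l v := by
    refine lt_of_le_of_ne (hlσ v (interior_subset hvint)) fun h => hl ?_
    rw [hv, map_sum] at h
    have := (Finset.sum_eq_zero_iff_of_nonneg fun i _ => hp i).1 h.symm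
    exact eq_zero_of_vanish u hfull l fun i => this i (Finset.mem_univ i)
  have hv0 : v ≠ 0 := fun h => by simp [h] at hlv
  refine ⟨⟨{x | x ∈ σ ∧ l x = 0}, ⟨⟨?_, ?_, ?_, ?_⟩, ?_⟩, ?_, ?_, ?_, ?_⟩, ⟨v, ?_, ?_⟩, ?_⟩
  · exact fun x hx => hσ ▸ hx.1
  · rintro x ⟨hx, hx'⟩ y ⟨hy, hy'⟩
    refine ⟨?_, by simp [hx', hy']⟩
    rw [hσ] at *
    exact coneGen_add hx hy
  · rintro x ⟨hx, hx'⟩ c hc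
    exact ⟨hsm hx hc, by simp [hx']⟩
  · rw [← hσ]
    rintro x hx y hy ⟨_, h⟩
    have h1 := hlσ x hx
    have h2 := hlσ y hy
    rw [map_add] at h
    exact ⟨⟨hx, by linarith⟩, ⟨hy, by linarith⟩⟩
  · apply le_antisymm
    · have hle : Submodule.span ℝ {x | x ∈ σ ∧ l x = 0} ≤ LinearMap.ker l := by
        rw [Submodule.span_le]
        exact fun x hx => hx.2
      have hlt : Submodule.span ℝ {x | x ∈ σ ∧ l x = 0} < ⊤ := by
        refine lt_of_le_of_lt hle (lt_top_iff_ne_top.2 fun h => hl (LinearMap.ker_eq_top.1 h))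
      have := Submodule.finrank_lt hlt.ne
      rw [Module.finrank_fin_fun] at this
      omega
    · refine hd.trans (Submodule.finrank_mono (Submodule.span_mono ?_))
      rintro _ ⟨i, hi, rfl⟩
      exact ⟨hσ ▸ coneGen_mem ⟨i, rfl⟩, hi⟩
  · intro x hx
    obtain ⟨a, ha, rfl⟩ := coneGen_singleton.1 hx
    exact coneGen_smul (coneGen_mem (by simp)) ha
  · exact fun x hx y hy => coneGen_add hx hy
  · exact fun x hx c hc => coneGen_smul hx hc
  · have key : ∀ x ∈ coneGen ({x | x ∈ σ ∧ l x = 0} ∪ {v}),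
        ∃ m ∈ σ, l m = 0 ∧ ∃ a : ℝ, 0 ≤ a ∧ x = m + a • v := by
      intro x hx
      have ha : ∀ x ∈ {x | x ∈ σ ∧ l x = 0}, ∀ y ∈ {x | x ∈ σ ∧ l x = 0},
          x + y ∈ {x | x ∈ σ ∧ l x = 0} := by
        rintro x ⟨hx, hx'⟩ y ⟨hy, hy'⟩
        refine ⟨?_, by simp [hx', hy']⟩
        rw [hσ] at *
        exact coneGen_add hx hy
      have hs : ∀ x ∈ {x | x ∈ σ ∧ l x = 0}, ∀ c : ℝ, 0 ≤ c →
          c • x ∈ {x | x ∈ σ ∧ l x = 0} := by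
        rintro x ⟨hx, hx'⟩ c hc
        exact ⟨hsm hx hc, by simp [hx']⟩
      obtain ⟨m, hm, h⟩ := coneGen_union ha hs hx
      rcases hm with hm | rfl
      · exact ⟨m, hm.1, hm.2, h⟩
      · exact ⟨0, hσ ▸ coneGen_zero _, by simp, h⟩
    intro x hx y hy hxy
    obtain ⟨m, hm, hlm, a, ha, rfl⟩ := key x hx
    obtain ⟨m', hm', hlm', b, hb, rfl⟩ := key y hy
    obtain ⟨c, hc, h⟩ := coneGen_singleton.1 hxy
    have h1 := congrArg l h
    simp only [map_add, map_smul, hlm, hlm', smul_eq_mul, zero_add] at h1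
    have h2 : c = a + b := by
      apply mul_right_cancel₀ hlv.ne'
      linarith
    have h3 : m + m' = 0 := by
      rw [h2, add_smul] at h
      have : m + m' + (a • v + b • v) = 0 + (a • v + b • v) := by
        rw [zero_add]; refine Eq.trans ?_ h; abel
      exact add_right_cancel this
    have h4 : m' = -m := by rw [eq_neg_iff_add_eq_zero, add_comm]; exact h3
    have h5 : m = 0 := hstronglyconvex m hm (h4 ▸ hm')
    rw [h4, h5]
    simp only [neg_zero, zero_add]
    exact ⟨coneGen_singleton.2 ⟨a, ha, rfl⟩, coneGen_singleton.2 ⟨b, hb, rfl⟩⟩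
  · rw [mem_intrinsicInterior]
    refine ⟨⟨v, subset_affineSpan ℝ _ (coneGen_mem rfl)⟩, ?_, rfl⟩
    rw [mem_interior]
    refine ⟨{y | 0 < l (y : Fin n → ℝ)}, ?_, ?_, hlv⟩
    · rintro ⟨y, hy⟩ (hly : 0 < l y)
      have hy' : y ∈ Submodule.span ℝ {v} := by
        have : affineSpan ℝ (coneGen {v}) ≤ (Submodule.span ℝ {v}).toAffineSubspace := by
          rw [affineSpan_le]
          intro x hx
          obtain ⟨a, ha, rfl⟩ := coneGen_singleton.1 hx
          exact Submodule.smul_mem _ _ (Submodule.mem_span_singleton_self v)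
        exact this hy
      obtain ⟨t, rfl⟩ := Submodule.mem_span_singleton.1 hy'
      rw [map_smul, smul_eq_mul] at hly
      exact coneGen_singleton.2 ⟨t, (pos_of_mul_pos_left hly hlv.le).le, rfl⟩
    · have : Continuous l := l.continuous_of_finiteDimensional
      exact isOpen_lt continuous_const (this.comp continuous_subtype_val)
  · exact interior_subset_intrinsicInterior hvint
  · rintro τ ⟨μ, ⟨⟨hμσ, hμa, hμs, hμf⟩, hμd⟩, hτs, hτa, hτm, hτf⟩ ⟨x, hxτ, hxσ⟩
    rw [← hσ] at hμσ hμf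
    have hxσ := mem_interior_of_intrinsic ⟨v, hvint⟩ hxσ
    have hxτ := intrinsicInterior_subset hxτ
    obtain ⟨m, hm, a, ha, rfl⟩ := coneGen_union hμa hμs (hτs hxτ)
    have hvτ : v ∈ τ := by
      rcases ha.eq_or_lt with rfl | ha
      · exfalso
        rw [zero_smul, add_zero] at hxσ
        rcases hm with hm | rfl
        · have : σ ⊆ μ := by
            intro y hy
            obtain ⟨ε, he, hy'⟩ := interior_dom hxσ (-y)
            have h1 := hμf _ hy' (ε • y) (hsm hy he.le) (by simpa using hm)
            have := hμs _ h1.2 ε⁻¹ (by positivity)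
            rwa [smul_smul, inv_mul_cancel₀ he.ne', one_smul] at this
          have h2 : Submodule.span ℝ μ = ⊤ := by
            rw [eq_top_iff, ← hfull]
            apply Submodule.span_mono
            rintro _ ⟨i, rfl⟩
            exact this (hσ ▸ coneGen_mem ⟨i, rfl⟩)
          rw [h2, finrank_top, Module.finrank_fin_fun] at hμd
          omega
        · exact h0 hxσ
      · have h1 : m ∈ coneGen (μ ∪ {v}) := by
          rcases hm with hm | rfl
          · exact coneGen_mem (Or.inl hm)
          · exact coneGen_zero _
        have h2 := (hτf m h1 (a • v) (coneGen_smul (coneGen_mem (by simp)) ha.le) hxτ).2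
        have := hτm _ h2 a⁻¹ (by positivity)
        rwa [smul_smul, inv_mul_cancel₀ ha.ne', one_smul] at this
    intro y hy
    obtain ⟨b, hb, rfl⟩ := coneGen_singleton.1 hy
    exact hτm _ hvτ b hb

/-- Let `σ*` be the star subdivision of a full-dimensional (strongly convex
rational polyhedral) cone `σ` with respect to the ray `ρ_v` generated by
`v = Star(σ) = u₁ + ⋯ + u_k`.  Then `ρ_v` is the unique minimal cone of `σ*` whose relative
interior meets the relative interior of `σ`: `ρ_v` is a cone of `σ*` whose relative
interior meets that of `σ`, and every cone of `σ*` whose relative interior meets the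
relative interior of `σ` contains `ρ_v`. -/
theorem stmt_1 {n k : ℕ} (u : Fin k → (Fin n → ℝ)) (hu : ∀ i, u i ≠ 0)
    (σ : Set (Fin n → ℝ)) (hσ : σ = coneGen (Set.range u))
    (hfull : Submodule.span ℝ (Set.range u) = ⊤)
    (hstronglyconvex : ∀ x ∈ σ, -x ∈ σ → x = 0)
    (v : Fin n → ℝ) (hv : v = ∑ i, u i) :
    coneGen {v} ∈ starSubdiv u v ∧
    (intrinsicInterior ℝ (coneGen {v}) ∩ intrinsicInterior ℝ σ).Nonempty ∧
    (∀ τ ∈ starSubdiv u v,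
      (intrinsicInterior ℝ τ ∩ intrinsicInterior ℝ σ).Nonempty → coneGen {v} ⊆ τ) := by
  by_cases hn : n ≠ 0
  · exact main_pos hn u σ hσ hfull hstronglyconvex v hv
  · have hn : n = 0 := not_not.1 hn
    subst hn
    have huniv : ∀ s : Set (Fin 0 → ℝ), s.Nonempty → s = Set.univ := fun s hs =>
      Subsingleton.eq_univ_of_nonempty hs
    have hcone : ∀ S : Set (Fin 0 → ℝ), coneGen S = Set.univ := fun S =>
      huniv _ ⟨0, coneGen_zero S⟩
    have hint : (0 : Fin 0 → ℝ) ∈ intrinsicInterior ℝ (Set.univ : Set (Fin 0 → ℝ)) :=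
      interior_subset_intrinsicInterior (by simp)
    refine ⟨⟨Set.univ, ⟨⟨?_, ?_, ?_, ?_⟩, ?_⟩, ?_, ?_, ?_, ?_⟩, ⟨0, ?_, ?_⟩, ?_⟩
    · simp [hcone]
    · simp
    · simp
    · simp
    · exact Module.finrank_zero_of_subsingleton
    · simp [hcone]
    · simp [hcone]
    · simp [hcone]
    · simp [hcone]
    · rw [hcone]; exact hint
    · rw [hσ, hcone]; exact hint
    · intro τ _ h
      obtain ⟨x, hx, _⟩ := h
      rw [huniv τ ⟨x, intrinsicInterior_subset hx⟩]
      exact Set.subset_univ _
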